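/- Let Π_h denote (a quasi-tree whose underlying tree is) the perfect binary tree of height h. Then dim(Π_h) = h for all h ≥ 0, and for all h ≥ 1 one has osc(Π_{2h−1}) = osc(Π_{2h}) = h; hence the upper bound dim(t) ≤ 2·osc(t) is off by exactly 1 for perfect binary trees of odd height. -/

import Mathlib

/-- The two-letter Dyck alphabet: `D.ab` is `ā` (the opening symbol) and `D.a` is `a`
(the closing symbol). -/
inductive D where
  | ab : D  -- ā
  | a : D   -- a
deriving DecidableEq

/-- Parse trees of the grammar `G_D = ({S}, {ā, a}, S, {S → ā S a S, S → ε})`: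
`eps` is an application of `S → ε` and `node t₁ t₂` an application of `S → ā S a S`. -/
inductive DyckTree where
  | eps : DyckTree
  | node : DyckTree → DyckTree → DyckTree

/-- The word generated by a parse tree of `G_D`. -/
def DyckTree.yield : DyckTree → List D
  | .eps => []
  | .node t₁ t₂ => D.ab :: (t₁.yield ++ D.a :: t₂.yield)

/-- The Dyck language `L_D`: the language generated by `G_D`. -/
def LD : Set (List D) := { w | ∃ t : DyckTree, t.yield = w }

/-- `Matches t i j` holds iff positions `i < j` (0-indexed) of the word `t.yield` form a
matching pair: position `i` carries `ā`, position `j` carries `a`, and the two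
corresponding leaves have the same parent in the parse tree `t`. -/
inductive Matches : DyckTree → ℕ → ℕ → Prop
  | head (t₁ t₂ : DyckTree) : Matches (.node t₁ t₂) 0 (t₁.yield.length + 1)
  | left {t₁ : DyckTree} {i j : ℕ} (t₂ : DyckTree) :
      Matches t₁ i j → Matches (.node t₁ t₂) (i + 1) (j + 1)
  | right {t₂ : DyckTree} {i j : ℕ} (t₁ : DyckTree) :
      Matches t₂ i j → Matches (.node t₁ t₂) (t₁.yield.length + 2 + i) (t₁.yield.length + 2 + j)

/-- `DelStep w v`: `v` results from `w ∈ L_D` by deleting (both positions of) one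
matching pair of `w`. -/
def DelStep (w v : List D) : Prop :=
  ∃ (t : DyckTree) (i j : ℕ), t.yield = w ∧ Matches t i j ∧
    v = (w.eraseIdx j).eraseIdx i

/-- The ordering `≼` on Dyck words: `dyckLE v w` (i.e. `v ≼ w`) holds iff `v` results
from `w` by deleting 0 or more matching pairs. -/
def dyckLE (v w : List D) : Prop := Relation.ReflTransGen DelStep w v

/-- The harmonics: `h_0 = ε` and `h_{i+1} = ā h_i a ā h_i a`. -/
def harmonicW : ℕ → List D
  | 0 => []
  | i + 1 => (D.ab :: (harmonicW i ++ [D.a])) ++ (D.ab :: (harmonicW i ++ [D.a]))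

/-- `ĥ_i = ā h_i a`. -/
def hatHarmonic (i : ℕ) : List D := D.ab :: (harmonicW i ++ [D.a])

/-- The rank of a Dyck word `w`: the greatest `q` such that `h_q ≼ w`. -/
noncomputable def rank (w : List D) : ℕ := sSup { q : ℕ | dyckLE (harmonicW q) w }

/-!
STATEMENT 6: Let `Π_h` denote (a quasi-tree whose underlying tree is) the perfect
binary tree of height `h`. Then `dim(Π_h) = h` for all `h ≥ 0`, and for all `h ≥ 1` one
has `osc(Π_{2h−1}) = osc(Π_{2h}) = h`; hence the upper bound `dim(t) ≤ 2·osc(t)` is off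
by exactly 1 for perfect binary trees of odd height.
-/

/-- Binary trees (the footprint and the dimension depend only on the shape of a tree). -/
inductive BTree where
  | leaf : BTree
  | br : BTree → BTree → BTree

/-- The footprint `α(n)` of a node: `α(n) = a` for a leaf,
`α(n) = a ā ā α(n₁) α(n₂)` for a node with two children `n₁, n₂`. -/
def alphaB : BTree → List D
  | .leaf => [D.a]
  | .br t₁ t₂ => D.a :: D.ab :: D.ab :: (alphaB t₁ ++ alphaB t₂)

/-- The footprint of the tree `t` with root `n`: `α(t) = ā α(n)`. -/
def alphaTB (t : BTree) : List D := D.ab :: alphaB t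

/-- The oscillation of a tree: `osc(t) = rank(α(t))`. -/
noncomputable def oscB (t : BTree) : ℕ := rank (alphaTB t)

/-- The dimension: 0 for a leaf; for a node with two children, the maximum of the
children's dimensions if it is attained by a unique child, and that maximum plus one
otherwise. -/
def dimB : BTree → ℕ
  | .leaf => 0
  | .br t₁ t₂ => if dimB t₁ = dimB t₂ then dimB t₁ + 1 else max (dimB t₁) (dimB t₂)

/-- The perfect binary tree `Π_h` of height `h`. -/
def perfectB : ℕ → BTree
  | 0 => .leaf
  | h + 1 => .br (perfectB h) (perfectB h)

namespace DyckTree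

/-- Concatenation of parse trees, corresponding to concatenation of the generated words. -/
def append : DyckTree → DyckTree → DyckTree
  | .eps, u => u
  | .node s t, u => .node s (t.append u)

theorem append_eps (t : DyckTree) : t.append .eps = t := by
  induction t with
  | eps => rfl
  | node s t _ iht => simp [append, iht]

theorem yield_append (t u : DyckTree) : (t.append u).yield = t.yield ++ u.yield := by
  induction t with
  | eps => rfl
  | node s t _ iht => simp [append, yield, iht]

theorem yield_append_closing_injective (s t : DyckTree) (u v : List D)
    (h : s.yield ++ D.a :: u = t.yield ++ D.a :: v) : s = t ∧ u = v := by
  induction s generalizing t u v with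
  | eps =>
    cases t with
    | eps => simpa [yield] using h
    | node t₁ t₂ => simp [yield] at h
  | node s₁ s₂ ih₁ ih₂ =>
    cases t with
    | eps => simp [yield] at h
    | node t₁ t₂ =>
      simp only [yield, List.cons_append, List.append_assoc, List.cons.injEq, true_and] at h
      obtain ⟨rfl, h'⟩ := ih₁ _ _ _ h
      obtain ⟨rfl, huv⟩ := ih₂ _ _ _ h'
      exact ⟨rfl, huv⟩

/-- The grammar `G_D` is unambiguous. -/
theorem yield_injective : Function.Injective yield := fun s t h =>
  (yield_append_closing_injective s t [] [] (by rw [h])).1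

/-- Deletion of one matching pair, on the level of parse trees. -/
inductive Del : DyckTree → DyckTree → Prop
  | head (s t : DyckTree) : Del (.node s t) (s.append t)
  | left {s s' : DyckTree} (t : DyckTree) : Del s s' → Del (.node s t) (.node s' t)
  | right {t t' : DyckTree} (s : DyckTree) : Del t t' → Del (.node s t) (.node s t')

end DyckTree

theorem Matches.exists_del {t : DyckTree} {i j : ℕ} (h : Matches t i j) :
    ∃ s x y z, DyckTree.Del t s ∧ t.yield = x ++ D.ab :: (y ++ D.a :: z) ∧
      s.yield = x ++ (y ++ z) ∧ i = x.length ∧ j = x.length + (y.length + 1) := by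
  induction h with
  | head s t =>
    exact ⟨s.append t, [], s.yield, t.yield, .head s t, rfl, s.yield_append t, rfl, by simp⟩
  | left t _ ih =>
    obtain ⟨s, x, y, z, hd, ht, hs, rfl, rfl⟩ := ih
    exact ⟨.node s t, D.ab :: x, y, z ++ D.a :: t.yield, .left t hd,
      by simp [DyckTree.yield, ht], by simp [DyckTree.yield, hs], by simp, by simp; omega⟩
  | right s _ ih =>
    obtain ⟨t, x, y, z, hd, ht, hs, rfl, rfl⟩ := ih
    exact ⟨.node s t, D.ab :: (s.yield ++ D.a :: x), y, z, .right s hd,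
      by simp [DyckTree.yield, ht], by simp [DyckTree.yield, hs], by simp; omega,
      by simp; omega⟩

theorem DyckTree.Del.exists_matches {t s : DyckTree} (h : t.Del s) :
    ∃ x y z, Matches t x.length (x.length + (y.length + 1)) ∧
      t.yield = x ++ D.ab :: (y ++ D.a :: z) ∧ s.yield = x ++ (y ++ z) := by
  induction h with
  | head s t =>
    exact ⟨[], s.yield, t.yield, by simpa using Matches.head s t, rfl, s.yield_append t⟩
  | left t _ ih =>
    obtain ⟨x, y, z, hm, ht, hs⟩ := ih
    refine ⟨D.ab :: x, y, z ++ D.a :: t.yield, ?_, by simp [yield, ht], by simp [yield, hs]⟩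
    convert Matches.left t hm using 1
    · exact List.length_cons
    · rw [List.length_cons]
      omega
  | right s _ ih =>
    obtain ⟨x, y, z, hm, ht, hs⟩ := ih
    refine ⟨D.ab :: (s.yield ++ D.a :: x), y, z, ?_, by simp [yield, ht], by simp [yield, hs]⟩
    convert Matches.right s hm using 1 <;>
    · simp only [List.length_cons, List.length_append]
      omega

theorem List.eraseIdx_eraseIdx_pair {α : Type*} (x y z : List α) (b c : α) :
    ((x ++ b :: (y ++ c :: z)).eraseIdx (x.length + (y.length + 1))).eraseIdx x.length
      = x ++ (y ++ z) := by
  have h (l m : List α) (k : ℕ) : (l ++ m).eraseIdx (l.length + k) = l ++ m.eraseIdx k := by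
    rw [List.eraseIdx_append_of_length_le (by omega), Nat.add_sub_cancel_left]
  have hy := h y (c :: z) 0
  have hx := h x (b :: (y ++ z)) 0
  simp only [Nat.add_zero, List.eraseIdx_cons_zero] at hx hy
  rw [h, List.eraseIdx_cons_succ, hy, hx]

theorem delStep_yield_iff {t : DyckTree} {v : List D} :
    DelStep t.yield v ↔ ∃ s, t.Del s ∧ s.yield = v := by
  constructor
  · rintro ⟨t', i, j, ht, hm, rfl⟩
    obtain rfl := DyckTree.yield_injective ht
    obtain ⟨s, x, y, z, hd, ht, hs, rfl, rfl⟩ := hm.exists_del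
    exact ⟨s, hd, by rw [ht, hs, List.eraseIdx_eraseIdx_pair]⟩
  · rintro ⟨s, hd, rfl⟩
    obtain ⟨x, y, z, hm, ht, hs⟩ := hd.exists_matches
    exact ⟨t, _, _, rfl, hm, by rw [ht, hs, List.eraseIdx_eraseIdx_pair]⟩

namespace DyckTree

/-- Deletion of finitely many matching pairs, on the level of parse trees. -/
abbrev Reduces : DyckTree → DyckTree → Prop := Relation.ReflTransGen Del

theorem dyckLE_yield_iff {s t : DyckTree} : dyckLE s.yield t.yield ↔ t.Reduces s := by
  constructor
  · intro h
    have key : ∀ w, Relation.ReflTransGen DelStep t.yield w →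
        ∃ u : DyckTree, u.yield = w ∧ t.Reduces u := by
      intro w hw
      induction hw with
      | refl => exact ⟨t, rfl, .refl⟩
      | tail _ hstep ih =>
        obtain ⟨u, rfl, hu⟩ := ih
        obtain ⟨u', hd, rfl⟩ := delStep_yield_iff.1 hstep
        exact ⟨u', rfl, hu.tail hd⟩
    obtain ⟨u, hu, htu⟩ := key _ h
    rwa [← yield_injective hu]
  · exact fun h => h.lift yield fun _ _ hd => delStep_yield_iff.2 ⟨_, hd, rfl⟩

theorem Reduces.node {s s' t t' : DyckTree} (hs : s.Reduces s') (ht : t.Reduces t') :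
    (DyckTree.node s t).Reduces (.node s' t') :=
  (hs.lift (DyckTree.node · t) fun _ _ => .left t).trans
    (ht.lift (DyckTree.node s') fun _ _ => .right s')

theorem reduces_eps (t : DyckTree) : t.Reduces .eps := by
  induction t with
  | eps => exact .refl
  | node s t ihs iht => exact (ihs.node iht).tail (.head .eps .eps)

theorem node_reduces_left (s t : DyckTree) : (node s t).Reduces s := by
  simpa only [append_eps] using
    (Reduces.node (s := s) .refl t.reduces_eps).tail (.head s .eps)

theorem node_reduces_right (s t : DyckTree) : (node s t).Reduces t :=
  (Reduces.node s.reduces_eps .refl).tail (.head .eps t)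

/-- The parse tree of the harmonic `h_i`. -/
def harmonic : ℕ → DyckTree
  | 0 => .eps
  | i + 1 => .node (harmonic i) (.node (harmonic i) .eps)

theorem yield_harmonic (i : ℕ) : (harmonic i).yield = harmonicW i := by
  induction i with
  | zero => rfl
  | succ i ih => simp [harmonic, harmonicW, yield, ih]

mutual

/-- A recursive description of the greatest `q` such that `h_q` embeds. -/
def harmonicRank : DyckTree → ℕ
  | .eps => 0
  | .node s t => max s.harmonicRank (max t.harmonicRank (min (s.harmonicRank + 1) t.hatRank))

/-- A recursive description of the number of `q` such that `ĥ_q = ā h_q a` embeds. -/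
def hatRank : DyckTree → ℕ
  | .eps => 0
  | .node s t => max (s.harmonicRank + 1) t.hatRank

end

theorem hatRank_le (t : DyckTree) : t.hatRank ≤ t.harmonicRank + 1 := by
  induction t with
  | eps => simp [hatRank]
  | node s t _ iht => simp only [hatRank, harmonicRank]; omega

theorem hatRank_append (s t : DyckTree) :
    (s.append t).hatRank = max s.hatRank t.hatRank := by
  induction s with
  | eps => simp [append, hatRank]
  | node s₁ s₂ _ ih => simp only [append, hatRank, ih]; omega

theorem harmonicRank_append (s t : DyckTree) :
    (s.append t).harmonicRank =
      max s.harmonicRank (max t.harmonicRank (min s.hatRank t.hatRank)) := by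
  induction s with
  | eps => simp [append, harmonicRank, hatRank]
  | node s₁ s₂ _ ih =>
    simp only [append, harmonicRank, hatRank, ih, hatRank_append]
    omega

theorem Del.rank_le {t s : DyckTree} (h : t.Del s) :
    s.harmonicRank ≤ t.harmonicRank ∧ s.hatRank ≤ t.hatRank := by
  induction h with
  | head s t =>
    have := s.hatRank_le
    simp only [harmonicRank_append, hatRank_append, harmonicRank, hatRank]
    omega
  | left t _ ih => simp only [harmonicRank, hatRank]; omega
  | right s _ ih => simp only [harmonicRank, hatRank]; omega

theorem Reduces.harmonicRank_le {t s : DyckTree} (h : t.Reduces s) :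
    s.harmonicRank ≤ t.harmonicRank := by
  induction h with
  | refl => exact le_rfl
  | tail _ hd ih => exact hd.rank_le.1.trans ih

theorem harmonicRank_harmonic (i : ℕ) : (harmonic i).harmonicRank = i := by
  induction i with
  | zero => simp [harmonic, harmonicRank]
  | succ i ih => simp [harmonic, harmonicRank, hatRank, ih]

theorem reduces_harmonic_and_hat (t : DyckTree) :
    (∀ q ≤ t.harmonicRank, t.Reduces (harmonic q)) ∧
      ∀ q < t.hatRank, t.Reduces (.node (harmonic q) .eps) := by
  induction t with
  | eps =>
    refine ⟨fun q hq => ?_, fun q hq => ?_⟩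
    · obtain rfl : q = 0 := by simpa [harmonicRank] using hq
      exact .refl
    · simp [hatRank] at hq
  | node s t ihs iht =>
    refine ⟨fun q hq => ?_, fun q hq => ?_⟩
    · simp only [harmonicRank, le_max_iff, le_min_iff] at hq
      rcases hq with hq | hq | ⟨hqs, hqt⟩
      · exact (node_reduces_left s t).trans (ihs.1 q hq)
      · exact (node_reduces_right s t).trans (iht.1 q hq)
      · cases q with
        | zero => exact reduces_eps _
        | succ q => exact (ihs.1 q (by omega)).node (iht.2 q (by omega))
    · simp only [hatRank, lt_max_iff] at hq
      rcases hq with hq | hq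
      · exact (ihs.1 q (by omega)).node t.reduces_eps
      · exact (node_reduces_right s t).trans (iht.2 q hq)

theorem rank_yield (t : DyckTree) : rank t.yield = t.harmonicRank := by
  refine IsGreatest.csSup_eq ⟨?_, fun q hq => ?_⟩
  · simpa only [Set.mem_ofPred_eq, ← yield_harmonic, dyckLE_yield_iff] using
      t.reduces_harmonic_and_hat.1 _ le_rfl
  · simp only [Set.mem_ofPred_eq, ← yield_harmonic, dyckLE_yield_iff] at hq
    simpa only [harmonicRank_harmonic] using hq.harmonicRank_le

end DyckTree

namespace BTree

/-- The parse tree of the footprint of a tree without its leading pair `āa`. -/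
def footprintTail : BTree → DyckTree
  | .leaf => .eps
  | .br s t => .node (.node .eps s.footprintTail) t.footprintTail

theorem alphaB_eq (t : BTree) : alphaB t = D.a :: t.footprintTail.yield := by
  induction t with
  | leaf => rfl
  | br s t ihs iht => simp [alphaB, footprintTail, DyckTree.yield, ihs, iht]

theorem oscB_eq (t : BTree) :
    oscB t = max t.footprintTail.harmonicRank (min 1 t.footprintTail.hatRank) := by
  have h : alphaTB t = (DyckTree.node .eps t.footprintTail).yield := by
    simp [alphaTB, alphaB_eq, DyckTree.yield]
  rw [oscB, h, DyckTree.rank_yield]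
  simp [DyckTree.harmonicRank]

end BTree

theorem dimB_perfectB (h : ℕ) : dimB (perfectB h) = h := by
  induction h with
  | zero => rfl
  | succ h ih => simp [perfectB, dimB, ih]

theorem footprintTail_perfectB_odd_ranks (k : ℕ) :
    (perfectB (2 * k + 1)).footprintTail.hatRank = k + 1 ∧
      (perfectB (2 * k + 1)).footprintTail.harmonicRank = if k = 0 then 0 else k + 1 := by
  induction k with
  | zero =>
    simp [perfectB, BTree.footprintTail, DyckTree.hatRank, DyckTree.harmonicRank]
  | succ k ih =>
    rw [show 2 * (k + 1) + 1 = 2 * k + 1 + 1 + 1 by ring, perfectB, perfectB]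
    simp only [BTree.footprintTail, DyckTree.hatRank, DyckTree.harmonicRank,
      Nat.add_eq_zero_iff, one_ne_zero, and_false, if_false]
    split_ifs at ih <;> omega

theorem oscB_perfectB_odd (k : ℕ) : oscB (perfectB (2 * k + 1)) = k + 1 := by
  rw [BTree.oscB_eq]
  have := footprintTail_perfectB_odd_ranks k
  split_ifs at this <;> omega

theorem oscB_perfectB_even (k : ℕ) : oscB (perfectB (2 * k + 2)) = k + 1 := by
  rw [BTree.oscB_eq, perfectB]
  have := footprintTail_perfectB_odd_ranks k
  simp only [BTree.footprintTail, DyckTree.hatRank, DyckTree.harmonicRank]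
  split_ifs at this <;> omega

theorem perfect_binary_dim_osc :
    (∀ h : ℕ, dimB (perfectB h) = h) ∧
    (∀ h : ℕ, 1 ≤ h → oscB (perfectB (2 * h - 1)) = h ∧ oscB (perfectB (2 * h)) = h) ∧
    -- for perfect binary trees of odd height the bound `dim ≤ 2·osc` is off by exactly 1:
    (∀ h : ℕ, 1 ≤ h → dimB (perfectB (2 * h - 1)) + 1 = 2 * oscB (perfectB (2 * h - 1))) := by
  have odd (h : ℕ) (hh : 1 ≤ h) : oscB (perfectB (2 * h - 1)) = h := by
    obtain ⟨k, rfl⟩ := Nat.exists_eq_add_of_le' hh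
    exact oscB_perfectB_odd k
  refine ⟨dimB_perfectB, fun h hh => ⟨odd h hh, ?_⟩, fun h hh => ?_⟩
  · obtain ⟨k, rfl⟩ := Nat.exists_eq_add_of_le' hh
    exact oscB_perfectB_even k
  · rw [dimB_perfectB, odd h hh]
    omega
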